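/- arXiv:1902.02318 — 3 statements merged into one kernel-verified Lean document; each statement's English description precedes it below -/
import Mathlib

section
/- For every integer k with k ≥ 1 and k ≠ 2, the double integrals satisfy I₁(k) = −π and I₂(k) = 0. -/
open Real

/-- The double integral `I₁(k)` from Lemma `lemmaI1I2`. -/
noncomputable def I₁ (k : ℤ) : ℝ :=
  ∫ β in (-π)..π, ∫ s in (0 : ℝ)..1,
    β * Real.cos (β * s) / (4 * Real.sin (β / 2) ^ 2) *
      Real.sin (((k : ℝ) - 1) * (s - 1) * β - β)

/-- The double integral `I₂(k)` from Lemma `lemmaI1I2`. -/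
noncomputable def I₂ (k : ℤ) : ℝ :=
  ∫ β in (-π)..π, ∫ s in (0 : ℝ)..1,
    β * Real.sin (β * s) / (4 * Real.sin (β / 2) ^ 2) *
      Real.cos (((k : ℝ) - 1) * (s - 1) * β - β)

theorem exG (n : ℕ) : (∃ G : ℝ → ℝ, Continuous G ∧ (∫ β in (-π)..π, G β) = π * n ∧
      ∀ β, 4 * Real.sin (β / 2) ^ 2 * G β = 1 - Real.cos (n * β)) ∧
    (∃ G : ℝ → ℝ, Continuous G ∧ (∫ β in (-π)..π, G β) = π * (n + 1) ∧
      ∀ β, 4 * Real.sin (β / 2) ^ 2 * G β = 1 - Real.cos ((n + 1) * β)) := by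
  have hs : ∀ β : ℝ, 4 * Real.sin (β / 2) ^ 2 = 2 * (1 - Real.cos β) := by
    intro β
    have h := Real.cos_two_mul (β / 2)
    have h2 := Real.sin_sq_add_cos_sq (β / 2)
    rw [show 2 * (β / 2) = β by ring] at h
    linarith
  induction n with
  | zero =>
    refine ⟨⟨fun _ => 0, continuous_const, by simp, by simp⟩,
      ⟨fun _ => 1 / 2, continuous_const, ?_, ?_⟩⟩
    · simp; ring
    · intro β; rw [hs]; simp; ring
  | succ n ih =>
    obtain ⟨⟨G, hG, hGi, hGe⟩, ⟨H, hH, hHi, hHe⟩⟩ := ih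
    refine ⟨⟨H, hH, by rw [hHi]; push_cast; ring, by intro β; rw [hHe]; push_cast; ring_nf⟩, ?_⟩
    have hc : Continuous fun β : ℝ => Real.cos (((n : ℝ) + 1) * β) := by fun_prop
    refine ⟨fun β => 2 * H β - G β + Real.cos (((n : ℝ) + 1) * β), by fun_prop, ?_, ?_⟩
    · have hn : (n : ℝ) + 1 ≠ 0 := by positivity
      have hci : (∫ β in (-π)..π, Real.cos (((n : ℝ) + 1) * β)) = 0 := by
        rw [intervalIntegral.integral_comp_mul_left (fun x => Real.cos x) hn, integral_cos]
        have := Real.sin_nat_mul_pi (n + 1)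
        push_cast at this
        rw [mul_neg, Real.sin_neg, this]; simp
      rw [intervalIntegral.integral_add, intervalIntegral.integral_sub,
        intervalIntegral.integral_const_mul, hGi, hHi, hci]
      · push_cast; ring
      all_goals apply Continuous.intervalIntegrable; fun_prop
    · intro β
      have h1 := hGe β
      have h2 := hHe β
      have e1 : Real.cos (((n + 1 : ℕ) + 1 : ℝ) * β)
          = Real.cos (((n : ℝ) + 1) * β) * Real.cos β
            - Real.sin (((n : ℝ) + 1) * β) * Real.sin β := by
        rw [← Real.cos_add]; push_cast; ring_nf
      have e2 : Real.cos ((n : ℝ) * β)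
          = Real.cos (((n : ℝ) + 1) * β) * Real.cos β
            + Real.sin (((n : ℝ) + 1) * β) * Real.sin β := by
        rw [← Real.cos_sub]; ring_nf
      rw [e1]
      rw [e2] at h1
      have h3 := hs β
      linear_combination 2 * h2 - h1 + Real.cos (((n : ℝ) + 1) * β) * h3

theorem intSin (a b β : ℝ) (ha : a ≠ 0) :
    (∫ s in (0 : ℝ)..1, β * Real.sin (a * (s - 1) * β - b))
      = (Real.cos (a * β + b) - Real.cos b) / a := by
  have hd : ∀ s ∈ Set.uIcc (0 : ℝ) 1,
      HasDerivAt (fun s => -Real.cos (a * (s - 1) * β - b) / a)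
        (β * Real.sin (a * (s - 1) * β - b)) s := by
    intro s _
    have h0 : HasDerivAt (fun s : ℝ => a * (s - 1) * β - b) (a * 1 * β) s :=
      (((((hasDerivAt_id s).sub_const 1).const_mul a).mul_const β).sub_const b)
    have h := (h0.cos.neg).div_const a
    refine h.congr_deriv ?_
    rw [div_eq_iff ha]
    ring
  rw [intervalIntegral.integral_eq_sub_of_hasDerivAt hd
    (by apply Continuous.intervalIntegrable; fun_prop)]
  have : a * (0 - 1) * β - b = -(a * β + b) := by ring
  rw [this, Real.cos_neg]
  simp
  ring

theorem aux (k : ℤ) (hk : 1 ≤ k) (hk2 : k ≠ 2) (σ : ℝ) (f : ℝ → ℝ → ℝ)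
    (hf : ∀ β s, f β s = 1 / (4 * Real.sin (β / 2) ^ 2) * (1 / 2) *
      (β * Real.sin ((k : ℝ) * (s - 1) * β - 0)
        + σ * (β * Real.sin (((k : ℝ) - 2) * (s - 1) * β - 2 * β)))) :
    (∫ β in (-π)..π, ∫ s in (0 : ℝ)..1, f β s) = - π / 2 * (1 + σ) := by
  obtain ⟨n, rfl⟩ := Int.eq_ofNat_of_zero_le (by omega : 0 ≤ k)
  have hn0 : ((n : ℤ) : ℝ) ≠ 0 := by
    have : (n : ℤ) ≠ 0 := by omega
    exact_mod_cast this
  have hn2 : ((n : ℤ) : ℝ) - 2 ≠ 0 := by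
    intro h
    apply hk2
    have : ((n : ℤ) : ℝ) = 2 := by linarith
    exact_mod_cast this
  obtain ⟨G, hG, hGi, hGe⟩ := (exG n).1
  obtain ⟨H, hH, hHi, hHe⟩ := (exG 2).1
  have key : ∀ β ∈ Set.uIoc (-π) π, β ≠ 0 → (∫ s in (0 : ℝ)..1, f β s)
      = (1 / 2) * (-(G β) / (n : ℤ) + σ * ((H β - G β) / ((n : ℤ) - 2))) := by
    intro β hβ h0
    rw [Set.uIoc_of_le (by linarith [Real.pi_pos])] at hβ
    have hsin : Real.sin (β / 2) ≠ 0 := by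
      intro h
      rw [Real.sin_eq_zero_iff_of_lt_of_lt (by linarith [hβ.1, Real.pi_pos])
        (by linarith [hβ.2, Real.pi_pos])] at h
      apply h0; linarith
    simp_rw [hf]
    rw [intervalIntegral.integral_const_mul, intervalIntegral.integral_add,
      intervalIntegral.integral_const_mul σ, intSin _ _ _ hn0, intSin _ _ _ hn2]
    · have h1 := hGe β
      have h2 := hHe β
      rw [show (((n : ℤ) : ℝ) - 2) * β + 2 * β = n * β by push_cast; ring,
        show ((n : ℤ) : ℝ) * β + 0 = n * β by push_cast; ring, Real.cos_zero,
        show Real.cos (n * β) = 1 - 4 * Real.sin (β / 2) ^ 2 * G β by linarith,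
        show Real.cos (2 * β) = 1 - 4 * Real.sin (β / 2) ^ 2 * H β by
          push_cast at h2; linarith]
      field_simp
      ring
    all_goals apply Continuous.intervalIntegrable; fun_prop
  have : (∫ β in (-π)..π, ∫ s in (0 : ℝ)..1, f β s) = ∫ β in (-π)..π,
      (1 / 2) * (-(G β) / (n : ℤ) + σ * ((H β - G β) / ((n : ℤ) - 2))) := by
    apply intervalIntegral.integral_congr_ae
    have h0 : ∀ᵐ β : ℝ, β ≠ 0 := by
      simp [MeasureTheory.ae_iff]
    filter_upwards [h0] with β hβ hm using key β hm hβ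
  rw [this, intervalIntegral.integral_const_mul, intervalIntegral.integral_add,
    intervalIntegral.integral_const_mul, intervalIntegral.integral_div,
    intervalIntegral.integral_div, intervalIntegral.integral_neg,
    intervalIntegral.integral_sub, hGi, hHi]
  · push_cast at hn0 hn2 ⊢
    field_simp
    ring
  all_goals apply Continuous.intervalIntegrable; fun_prop

/-- For every integer `k ≥ 1` with `k ≠ 2`:  `I₁(k) = −π` and `I₂(k) = 0`. -/
theorem stmt3 (k : ℤ) (hk : 1 ≤ k) (hk2 : k ≠ 2) : I₁ k = -π ∧ I₂ k = 0 := by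
  have e : ∀ β s : ℝ, Real.sin ((k : ℝ) * (s - 1) * β - 0)
      = Real.sin (((k : ℝ) - 1) * (s - 1) * β - β) * Real.cos (β * s)
        + Real.cos (((k : ℝ) - 1) * (s - 1) * β - β) * Real.sin (β * s) := by
    intro β s
    rw [← Real.sin_add]; ring_nf
  have e' : ∀ β s : ℝ, Real.sin (((k : ℝ) - 2) * (s - 1) * β - 2 * β)
      = Real.sin (((k : ℝ) - 1) * (s - 1) * β - β) * Real.cos (β * s)
        - Real.cos (((k : ℝ) - 1) * (s - 1) * β - β) * Real.sin (β * s) := by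
    intro β s
    rw [← Real.sin_sub]; ring_nf
  constructor
  · unfold I₁
    rw [aux k hk hk2 1 _ (by intro β s; rw [e, e']; ring)]
    ring
  · unfold I₂
    rw [aux k hk hk2 (-1) _ (by intro β s; rw [e, e']; ring)]
    ring
end

section
/- For every integer k with k ≤ −1, the double integrals satisfy I₁(k) = −kπ/(2−k) and I₂(k) = 2π/(2−k). -/
open Real

/-- Fejer-type kernel. -/
noncomputable def FF (n : ℕ) (β : ℝ) : ℝ := (1 - Real.cos (n * β)) / (4 * Real.sin (β / 2) ^ 2)

lemma FF_rec (n : ℕ) (β : ℝ) (h : Real.sin (β / 2) ≠ 0) :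
    2 * FF (n + 1) β - FF n β + Real.cos (((n + 1 : ℕ) : ℝ) * β) = FF (n + 2) β := by
  unfold FF
  have h1 : Real.cos (((n + 2 : ℕ) : ℝ) * β) + Real.cos (n * β)
      = 2 * Real.cos (((n + 1 : ℕ) : ℝ) * β) * Real.cos β := by
    have e1 : ((n + 2 : ℕ) : ℝ) * β = ((n + 1 : ℕ) : ℝ) * β + β := by push_cast; ring
    have e2 : (n : ℝ) * β = ((n + 1 : ℕ) : ℝ) * β - β := by push_cast; ring
    rw [e1, e2, Real.cos_add, Real.cos_sub]; ring
  have h2 : Real.cos β = 1 - 2 * Real.sin (β / 2) ^ 2 := by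
    have := Real.cos_sq_add_sin_sq (β / 2)
    have h3 := Real.cos_two_mul (β / 2)
    rw [show 2 * (β / 2) = β by ring] at h3
    rw [h3]; linarith
  rw [h2] at h1
  generalize Real.cos (((n + 2 : ℕ) : ℝ) * β) = a at *
  generalize Real.cos (((n + 1 : ℕ) : ℝ) * β) = b at *
  generalize Real.cos ((n : ℝ) * β) = c at *
  field_simp
  linear_combination h1

lemma sin_ne_ae : ∀ᵐ β : ℝ, β ∈ Set.uIoc (-π) π → Real.sin (β / 2) ≠ 0 := by
  have h0 : ∀ᵐ β : ℝ, β ≠ 0 := by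
    simp [MeasureTheory.ae_iff]
  filter_upwards [h0] with β hβ hm hs
  rw [Set.uIoc_of_le (by linarith [Real.pi_pos])] at hm
  have := (Real.sin_eq_zero_iff_of_lt_of_lt (x := β / 2)
    (by linarith [hm.1, Real.pi_pos]) (by linarith [hm.2, Real.pi_pos])).1 hs
  apply hβ; linarith

lemma FF_main (n : ℕ) :
    (IntervalIntegrable (FF n) MeasureTheory.volume (-π) π ∧ ∫ β in (-π)..π, FF n β = n * π) ∧
    (IntervalIntegrable (FF (n + 1)) MeasureTheory.volume (-π) π ∧
      ∫ β in (-π)..π, FF (n + 1) β = (n + 1 : ℕ) * π) := by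
  induction n with
  | zero =>
    have e0 : FF 0 = fun _ => 0 := by funext β; simp [FF]
    have e1 : ∀ᵐ β : ℝ, β ∈ Set.uIoc (-π) π → (1 / 2 : ℝ) = FF (0 + 1) β := by
      filter_upwards [sin_ne_ae] with β h hm
      have h := h hm
      have h3 := Real.cos_two_mul (β / 2)
      have := Real.cos_sq_add_sin_sq (β / 2)
      rw [show 2 * (β / 2) = β by ring] at h3
      simp only [FF, zero_add, Nat.cast_one, one_mul]
      rw [h3]
      field_simp
      linarith
    refine ⟨⟨by rw [e0]; exact intervalIntegrable_const, by rw [e0]; simp⟩, ?_, ?_⟩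
    · refine (intervalIntegrable_const (c := (1 / 2 : ℝ))).congr_ae ?_
      exact (MeasureTheory.ae_restrict_iff' measurableSet_uIoc).2 e1
    · rw [← intervalIntegral.integral_congr_ae e1]
      simp; ring
  | succ n ih =>
    obtain ⟨⟨i0, v0⟩, i1, v1⟩ := ih
    refine ⟨⟨i1, v1⟩, ?_⟩
    have ic : IntervalIntegrable (fun β : ℝ => Real.cos (((n + 1 : ℕ) : ℝ) * β))
        MeasureTheory.volume (-π) π := by
      apply Continuous.intervalIntegrable; fun_prop
    have vc : ∫ β in (-π)..π, Real.cos (((n + 1 : ℕ) : ℝ) * β) = 0 := by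
      rw [intervalIntegral.integral_comp_mul_left (fun x => Real.cos x)
        (by positivity : ((n + 1 : ℕ) : ℝ) ≠ 0), integral_cos, mul_neg, Real.sin_neg,
        Real.sin_nat_mul_pi]
      simp
    have e : ∀ᵐ β : ℝ, β ∈ Set.uIoc (-π) π →
        2 * FF (n + 1) β - FF n β + Real.cos (((n + 1 : ℕ) : ℝ) * β) = FF (n + 1 + 1) β := by
      filter_upwards [sin_ne_ae] with β h hm
      exact FF_rec n β (h hm)
    have is : IntervalIntegrable (fun β => 2 * FF (n + 1) β - FF n β)
        MeasureTheory.volume (-π) π := (i1.const_mul 2).sub i0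
    refine ⟨(is.add ic).congr_ae ((MeasureTheory.ae_restrict_iff' measurableSet_uIoc).2 e), ?_⟩
    rw [← intervalIntegral.integral_congr_ae e, intervalIntegral.integral_add is ic,
      intervalIntegral.integral_sub (i1.const_mul 2) i0, intervalIntegral.integral_const_mul,
      v0, v1, vc]
    push_cast; ring

lemma inner_aux (k β c d : ℝ) (hk : k ≠ 0) (hk2 : k - 2 ≠ 0) :
    ∫ s in (0 : ℝ)..1, c * (β * Real.sin (k * β * (s - 1))
        + d * (β * Real.sin ((k - 2) * β * (s - 1) - 2 * β)))
      = c * ((Real.cos (k * β) - 1) / k + d * ((Real.cos (k * β) - Real.cos (2 * β)) / (k - 2))) := by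
  have hd : ∀ s ∈ Set.uIcc (0 : ℝ) 1, HasDerivAt (fun s : ℝ =>
      c * (-Real.cos (k * β * (s - 1)) / k
        + d * (-Real.cos ((k - 2) * β * (s - 1) - 2 * β) / (k - 2))))
      (c * (β * Real.sin (k * β * (s - 1))
        + d * (β * Real.sin ((k - 2) * β * (s - 1) - 2 * β)))) s := by
    intro s _
    have a1 : HasDerivAt (fun s : ℝ => k * β * (s - 1)) (k * β) s := by
      simpa using ((hasDerivAt_id s).sub_const 1).const_mul (k * β)
    have a2 : HasDerivAt (fun s : ℝ => (k - 2) * β * (s - 1) - 2 * β) ((k - 2) * β) s := by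
      simpa using (((hasDerivAt_id s).sub_const 1).const_mul ((k - 2) * β)).sub_const (2 * β)
    have := (((a1.cos.neg.div_const k)).add (((a2.cos.neg.div_const (k - 2))).const_mul d)).const_mul c
    refine this.congr_deriv ?_
    field_simp
  rw [intervalIntegral.integral_eq_sub_of_hasDerivAt hd
    (Continuous.intervalIntegrable (by fun_prop) _ _)]
  have e1 : k * β * (0 - 1) = -(k * β) := by ring
  have e2 : (k - 2) * β * (0 - 1) - 2 * β = -(k * β) := by ring
  have e3 : (k - 2) * β * (1 - 1) - 2 * β = -(2 * β) := by ring
  rw [e1, e2, e3]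
  simp only [sub_self, mul_zero, Real.cos_zero, Real.cos_neg]
  ring

lemma outer_aux (n : ℕ) (k d : ℝ) (hk : k = -n) :
    ∫ β in (-π)..π, (1 / (8 * Real.sin (β / 2) ^ 2)) *
      ((Real.cos (k * β) - 1) / k + d * ((Real.cos (k * β) - Real.cos (2 * β)) / (k - 2)))
      = (-1 / (2 * k)) * (n * π) + (d / (2 * (k - 2))) * (2 * π - n * π) := by
  obtain ⟨⟨i0, v0⟩, -⟩ := FF_main n
  obtain ⟨⟨i2, v2⟩, -⟩ := FF_main 2
  have e : ∀ β : ℝ, (1 / (8 * Real.sin (β / 2) ^ 2)) *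
      ((Real.cos (k * β) - 1) / k + d * ((Real.cos (k * β) - Real.cos (2 * β)) / (k - 2)))
      = (-1 / (2 * k)) * FF n β + (d / (2 * (k - 2))) * (FF 2 β - FF n β) := by
    intro β
    have : Real.cos (k * β) = Real.cos (n * β) := by rw [hk, neg_mul, Real.cos_neg]
    rw [this]
    simp only [FF, Nat.cast_ofNat, div_eq_mul_inv, mul_inv]
    ring
  simp only [e]
  rw [intervalIntegral.integral_add (i0.const_mul _) ((i2.sub i0).const_mul _),
    intervalIntegral.integral_const_mul, intervalIntegral.integral_const_mul,
    intervalIntegral.integral_sub i2 i0, v0, v2]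
  norm_num

/-- For every integer `k ≤ −1`:  `I₁(k) = −kπ/(2−k)` and `I₂(k) = 2π/(2−k)`. -/
theorem stmt4 (k : ℤ) (hk : k ≤ -1) :
    I₁ k = -(k : ℝ) * π / (2 - (k : ℝ)) ∧ I₂ k = 2 * π / (2 - (k : ℝ)) := by
  obtain ⟨n, hn⟩ : ∃ n : ℕ, k = -(n : ℤ) := ⟨k.natAbs, by omega⟩
  have hkn : (k : ℝ) = -(n : ℝ) := by rw [hn]; push_cast; ring
  have hkr : (k : ℝ) ≤ -1 := by exact_mod_cast hk
  have hn' : (n : ℝ) = -(k : ℝ) := by linarith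
  have hk0 : (k : ℝ) ≠ 0 := by linarith
  have hk2 : (k : ℝ) - 2 ≠ 0 := by linarith
  have hk3 : 2 - (k : ℝ) ≠ 0 := by linarith
  unfold I₁ I₂
  generalize (k : ℝ) = x at *
  have key : ∀ β s : ℝ,
      β * Real.cos (β * s) / (4 * Real.sin (β / 2) ^ 2) * Real.sin ((x - 1) * (s - 1) * β - β)
      = (1 / (8 * Real.sin (β / 2) ^ 2)) * (β * Real.sin (x * β * (s - 1))
        + 1 * (β * Real.sin ((x - 2) * β * (s - 1) - 2 * β))) ∧
      β * Real.sin (β * s) / (4 * Real.sin (β / 2) ^ 2) * Real.cos ((x - 1) * (s - 1) * β - β)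
      = (1 / (8 * Real.sin (β / 2) ^ 2)) * (β * Real.sin (x * β * (s - 1))
        + (-1) * (β * Real.sin ((x - 2) * β * (s - 1) - 2 * β))) := by
    intro β s
    have e1 : x * β * (s - 1) = ((x - 1) * (s - 1) * β - β) + β * s := by ring
    have e2 : (x - 2) * β * (s - 1) - 2 * β = ((x - 1) * (s - 1) * β - β) - β * s := by ring
    rw [e1, e2, Real.sin_add, Real.sin_sub _ (β * s)]
    simp only [div_eq_mul_inv, mul_inv]
    constructor <;> ring
  have k1 := fun β s => (key β s).1
  have k2 := fun β s => (key β s).2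
  simp only [k1, k2, inner_aux x _ _ _ hk0 hk2]
  rw [outer_aux n x 1 hkn, outer_aux n x (-1) hkn, hn']
  constructor
  · rw [← neg_sub x 2]; field_simp; ring
  · rw [← neg_sub x 2]; field_simp; ring
end

section
/- For every integer ℓ, the principal value integral lim_{ε→0⁺} ∫_{ε ≤ |β| ≤ π} e^{−iℓβ}/(1 − e^{−iβ}) dβ exists and equals π if ℓ ≤ 0 and equals −π if ℓ ≥ 1. -/
open Real Filter

/-- The integrand. -/
noncomputable def pvF (l : ℤ) (β : ℝ) : ℂ :=
  Complex.exp (-Complex.I * (l : ℂ) * (β : ℂ)) / (1 - Complex.exp (-Complex.I * (β : ℂ)))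

lemma pv_den_ne (β : ℝ) (h0 : β ≠ 0) (h1 : |β| ≤ π) :
    1 - Complex.exp (-Complex.I * (β : ℂ)) ≠ 0 := by
  intro h
  have h2 : Complex.exp (-Complex.I * (β : ℂ)) = 1 := (sub_eq_zero.mp h).symm
  rw [Complex.exp_eq_one_iff] at h2
  obtain ⟨n, hn⟩ := h2
  have h3 : -β = n * (2 * π) := by
    have := congrArg Complex.im hn
    simpa using this
  have hpi := Real.pi_pos
  have hn0 : n ≠ 0 := by
    rintro rfl
    apply h0
    simpa using h3
  have h4 : (1 : ℝ) ≤ |(n : ℝ)| := by exact_mod_cast Int.one_le_abs hn0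
  have h5 : |β| = |(n : ℝ)| * (2 * π) := by
    rw [← abs_neg, h3, abs_mul, abs_of_pos (by positivity : 0 < 2 * π)]
  nlinarith

lemma pv_step (l : ℤ) (β : ℝ) (h0 : β ≠ 0) (h1 : |β| ≤ π) :
    pvF l β - pvF (l + 1) β = Complex.exp (-Complex.I * (l : ℂ) * (β : ℂ)) := by
  have := pv_den_ne β h0 h1
  have e : Complex.exp (-Complex.I * ((l + 1 : ℤ) : ℂ) * (β : ℂ)) =
      Complex.exp (-Complex.I * (l : ℂ) * (β : ℂ)) * Complex.exp (-Complex.I * (β : ℂ)) := by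
    rw [← Complex.exp_add]; congr 1; push_cast; ring
  unfold pvF
  rw [e, ← sub_div, div_eq_iff this]
  ring

lemma pv_step2 (l : ℤ) (β : ℝ) (h0 : β ≠ 0) (h1 : |β| ≤ π) :
    pvF l β + pvF l (-β) - (pvF (l + 1) β + pvF (l + 1) (-β)) = ((2 * Real.cos (l * β) : ℝ) : ℂ) := by
  have a := pv_step l β h0 h1
  have b := pv_step l (-β) (by simpa using h0) (by simpa using h1)
  have c : ((2 * Real.cos (l * β) : ℝ) : ℂ) = Complex.exp (-Complex.I * (l : ℂ) * (β : ℂ)) +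
      Complex.exp (-Complex.I * (l : ℂ) * ((-β : ℝ) : ℂ)) := by
    push_cast
    rw [Complex.two_cos, add_comm]
    congr 2 <;> ring
  rw [c, ← a, ← b]; ring

lemma pv_zero (β : ℝ) (h0 : β ≠ 0) (h1 : |β| ≤ π) : pvF 0 β + pvF 0 (-β) = 1 := by
  have a := pv_den_ne β h0 h1
  have b := pv_den_ne (-β) (by simpa using h0) (by simpa using h1)
  have e : Complex.exp (-Complex.I * (β : ℂ)) * Complex.exp (-Complex.I * ((-β : ℝ) : ℂ)) = 1 := by
    rw [← Complex.exp_add]; simp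
  unfold pvF
  simp only [Int.cast_zero, mul_zero, zero_mul, Complex.exp_zero]
  rw [div_add_div _ _ a b, div_eq_one_iff_eq (mul_ne_zero a b)]
  linear_combination -e

lemma pv_cos (l : ℤ) : ∫ β in (0 : ℝ)..π, (2 * Real.cos (l * β)) = if l = 0 then 2 * π else 0 := by
  split_ifs with h
  · subst h; simp; ring
  · have : (l : ℝ) ≠ 0 := by exact_mod_cast h
    rw [intervalIntegral.integral_const_mul, intervalIntegral.integral_comp_mul_left _ this]
    simp [Real.sin_int_mul_pi]

lemma pv_ext (l : ℤ) : ∃ h : ℝ → ℂ, Continuous h ∧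
    (∀ β : ℝ, β ≠ 0 → |β| ≤ π → pvF l β + pvF l (-β) = h β) ∧
    ∫ β in (0 : ℝ)..π, h β = if l ≤ 0 then (π : ℂ) else (-π : ℂ) := by
  have cc : ∀ l : ℤ, Continuous (fun β : ℝ => ((2 * Real.cos (l * β) : ℝ) : ℂ)) := by
    intro l; fun_prop
  have ci : ∀ l : ℤ, ∫ β in (0 : ℝ)..π, ((2 * Real.cos (l * β) : ℝ) : ℂ) =
      if l = 0 then 2 * (π : ℂ) else 0 := by
    intro l
    rw [intervalIntegral.integral_ofReal, pv_cos]
    split_ifs <;> simp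
  induction l using Int.induction_on with
  | zero => exact ⟨fun _ => 1, continuous_const, pv_zero, by simp⟩
  | succ n ih =>
    obtain ⟨h, hc, he, hi⟩ := ih
    refine ⟨fun β => h β - ((2 * Real.cos ((n : ℤ) * β) : ℝ) : ℂ), hc.sub (cc n), ?_, ?_⟩
    · intro β h0 h1
      beta_reduce; rw [← pv_step2 n β h0 h1, ← he β h0 h1]; ring
    · rw [intervalIntegral.integral_sub (hc.intervalIntegrable _ _)
        ((cc n).intervalIntegrable _ _), hi, ci]
      rcases Nat.eq_zero_or_pos n with rfl | hn
      · simp; ring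
      · rw [if_neg (by omega), if_neg (by omega), if_neg (by omega)]; ring
  | pred n ih =>
    obtain ⟨h, hc, he, hi⟩ := ih
    refine ⟨fun β => h β + ((2 * Real.cos ((-(n : ℤ) - 1 : ℤ) * β) : ℝ) : ℂ),
      hc.add (cc _), ?_, ?_⟩
    · intro β h0 h1
      have := he β h0 h1
      beta_reduce; rw [← pv_step2 _ β h0 h1, ← this, sub_add_cancel]; ring
    · rw [intervalIntegral.integral_add (hc.intervalIntegrable _ _)
        ((cc _).intervalIntegrable _ _), hi, ci]
      rw [if_pos (by omega), if_neg (by omega), if_pos (by omega)]; ring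

lemma pv_set (l : ℤ) (ε : ℝ) (h0 : 0 < ε) (h1 : ε ≤ π) :
    ∫ β in {β : ℝ | ε ≤ |β| ∧ |β| ≤ π}, pvF l β = ∫ β in ε..π, (pvF l β + pvF l (-β)) := by
  have hs : {β : ℝ | ε ≤ |β| ∧ |β| ≤ π} = Set.Icc ε π ∪ Set.Icc (-π) (-ε) := by
    ext β
    simp only [Set.mem_ofPred_eq, Set.mem_union, Set.mem_Icc]
    rcases abs_cases β with ⟨h, _⟩ | ⟨h, _⟩ <;> rw [h] <;> constructor
    · intro h; left; exact h
    · rintro (h | h)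
      · exact h
      · constructor <;> linarith
    · rintro ⟨a, b⟩; right; constructor <;> linarith
    · rintro (⟨a, b⟩ | ⟨a, b⟩) <;> constructor <;> linarith
  have hcont : ContinuousOn (pvF l) {β : ℝ | ε ≤ |β| ∧ |β| ≤ π} := by
    unfold pvF
    apply ContinuousOn.div (by fun_prop) (by fun_prop)
    rintro β ⟨a, b⟩
    exact pv_den_ne β (by rintro rfl; simp at a; linarith) b
  rw [hs] at hcont
  have c1 := hcont.mono Set.subset_union_left
  have c2 := hcont.mono Set.subset_union_right
  have i2 : IntervalIntegrable (pvF l) MeasureTheory.volume (-π) (-ε) :=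
    ContinuousOn.intervalIntegrable_of_Icc (by linarith) c2
  have i1 : IntervalIntegrable (pvF l) MeasureTheory.volume ε π :=
    ContinuousOn.intervalIntegrable_of_Icc h1 c1
  have i3 : IntervalIntegrable (fun β => pvF l (-β)) MeasureTheory.volume ε π := by
    apply ContinuousOn.intervalIntegrable_of_Icc h1
    apply c2.comp (by fun_prop)
    intro x hx
    simp only [Set.mem_Icc] at hx ⊢
    constructor <;> linarith
  rw [hs, MeasureTheory.setIntegral_union _ measurableSet_Icc c1.integrableOn_Icc
    c2.integrableOn_Icc, intervalIntegral.integral_add i1 i3,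
    intervalIntegral.integral_comp_neg (fun x => pvF l x),
    MeasureTheory.integral_Icc_eq_integral_Ioc, MeasureTheory.integral_Icc_eq_integral_Ioc,
    intervalIntegral.integral_of_le h1, intervalIntegral.integral_of_le (by linarith)]
  rw [Set.disjoint_left]
  rintro x ⟨a, _⟩ ⟨_, b⟩
  linarith

/-- For every integer `ℓ`, the principal value
`lim_{ε→0⁺} ∫_{ε ≤ |β| ≤ π} e^{−iℓβ}/(1 − e^{−iβ}) dβ`
exists and equals `π` if `ℓ ≤ 0` and `−π` if `ℓ ≥ 1`. -/
theorem stmt8 (ℓ : ℤ) :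
    Tendsto (fun ε : ℝ =>
        ∫ β in {β : ℝ | ε ≤ |β| ∧ |β| ≤ π},
          Complex.exp (-Complex.I * (ℓ : ℂ) * (β : ℂ)) / (1 - Complex.exp (-Complex.I * (β : ℂ))))
      (nhdsWithin 0 (Set.Ioi 0))
      (nhds (if ℓ ≤ 0 then (π : ℂ) else (-π : ℂ))) := by
  obtain ⟨h, hc, he, hi⟩ := pv_ext ℓ
  have hcont : Continuous (fun ε : ℝ => ∫ β in ε..π, h β) := by
    simp_rw [fun ε : ℝ => intervalIntegral.integral_symm (μ := MeasureTheory.volume) (f := h) π ε]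
    exact (intervalIntegral.continuous_primitive (fun a b => hc.intervalIntegrable a b) π).neg
  have ht := (hcont.tendsto 0).mono_left (nhdsWithin_le_nhds (s := Set.Ioi 0))
  rw [hi] at ht
  refine ht.congr' ?_
  filter_upwards [Ioc_mem_nhdsGT Real.pi_pos] with ε hε
  refine Eq.trans ?_ (pv_set ℓ ε hε.1 hε.2).symm
  apply intervalIntegral.integral_congr
  intro β hβ
  rw [Set.uIcc_of_le hε.2] at hβ
  have hp : 0 < β := lt_of_lt_of_le hε.1 hβ.1
  exact (he β hp.ne' (by rw [abs_of_pos hp]; exact hβ.2)).symm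
end
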